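/- Let n ≥ 2, p ∈ Sⁿ and r ∈ (0, π/2). For all z, z′ ∈ Sⁿ with z·p < z′·p one has ∫_{B_{p,r}} G(z·v) dv < ∫_{B_{p,r}} G(z′·v) dv; that is, the function G_r on [−1,1] defined by G_r(z·p) = ∫_{B_{p,r}} G(z·v) dv is strictly increasing. -/

import Mathlib

open MeasureTheory Real
open scoped RealInnerProductSpace

noncomputable section

/-- The unit sphere `Sⁿ ⊆ ℝ^{n+1}`. -/
def sph (n : ℕ) : Set (EuclideanSpace ℝ (Fin (n + 1))) := Metric.sphere 0 1

/-- Reflection `R_a(z) = z - 2(z·a)a` across the hyperplane `a^⊥`. -/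
def sphRefl (n : ℕ) (a z : EuclideanSpace ℝ (Fin (n + 1))) : EuclideanSpace ℝ (Fin (n + 1)) :=
  z - (2 * ⟪z, a⟫) • a

/-- The folding map `F_a` : reflect the open half-sphere `{z·a > 0}` onto `{z·a < 0}`. -/
def fold (n : ℕ) (a z : EuclideanSpace ℝ (Fin (n + 1))) : EuclideanSpace ℝ (Fin (n + 1)) :=
  if 0 < ⟪z, a⟫ then sphRefl n a z else z

/-- Projection `π_z(w) = w - (w·z)z` onto the tangent space `z^⊥`. -/
def proj (n : ℕ) (z w : EuclideanSpace ℝ (Fin (n + 1))) : EuclideanSpace ℝ (Fin (n + 1)) :=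
  w - ⟪w, z⟫ • z

/-- The open geodesic ball `B_{p,r}` on the unit sphere: points of the sphere at geodesic
(angular) distance `arccos (p·v) < r` from `p`. -/
def gball (n : ℕ) (p : EuclideanSpace ℝ (Fin (n + 1))) (r : ℝ) :
    Set (EuclideanSpace ℝ (Fin (n + 1))) :=
  {v | v ∈ sph n ∧ Real.arccos ⟪p, v⟫ < r}

/-- `G(t) = ∫₀ᵗ g(s) ds`. -/
def Gfun (g : ℝ → ℝ) (t : ℝ) : ℝ := ∫ s in (0:ℝ)..t, g s

theorem aux_finrank (n : ℕ) (v : EuclideanSpace ℝ (Fin (n + 1))) (hv : ‖v‖ = 1) :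
    Module.finrank ℝ (Submodule.span ℝ {v})ᗮ = n := by
  have : Fact (Module.finrank ℝ (EuclideanSpace ℝ (Fin (n + 1))) = n + 1) := ⟨by simp⟩
  exact Submodule.finrank_orthogonal_span_singleton (by rintro rfl; simp at hv)

theorem aux_haar (n : ℕ) (v : EuclideanSpace ℝ (Fin (n + 1))) (hv : ‖v‖ = 1) :
    Measure.IsAddHaarMeasure (G := (Submodule.span ℝ {v})ᗮ) μH[(n:ℝ)] := by
  have h := isAddHaarMeasure_hausdorffMeasure (E := (Submodule.span ℝ {v})ᗮ)
  rwa [aux_finrank n v hv] at h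

theorem aux_left (n : ℕ) (x v : EuclideanSpace ℝ (Fin (n + 1))) (hv : ‖v‖ = 1)
    (hx : ‖x‖ = 1) (hxv : x ≠ v) :
    stereoInvFunAux v (stereoToFun v x : EuclideanSpace ℝ (Fin (n + 1))) = x := by
  have := stereo_left_inv hv (x := ⟨x, by simpa using hx⟩) hxv
  exact congrArg Subtype.val this

theorem aux_cdat (n : ℕ) (x v : EuclideanSpace ℝ (Fin (n + 1))) (hv : ‖v‖ = 1)
    (hx : ‖x‖ = 1) (hxv : x ≠ v) : ContDiffAt ℝ 1 (stereoToFun v) x := by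
  refine (contDiffOn_stereoToFun (v := v) (n := 1)).contDiffAt ?_
  refine IsOpen.mem_nhds ?_ ?_
  · exact isOpen_ne_fun (innerSL ℝ v).continuous continuous_const
  · simp only [Set.mem_ofPred_eq, innerSL_apply_apply]
    exact ((inner_lt_one_iff_real_of_norm_eq_one hv hx).2 hxv.symm).ne

theorem aux_ne (n : ℕ) (x : EuclideanSpace ℝ (Fin (n + 1)))
    (hx : ‖x‖ = 1) : x ≠ -x := by
  intro h
  have h2 : (2:ℝ) • x = 0 := by
    rw [two_smul]; nth_rewrite 2 [h]; simp
  have : x = 0 := (smul_eq_zero.1 h2).resolve_left two_ne_zero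
  simp [this] at hx

theorem aux_cd (n : ℕ) (v : EuclideanSpace ℝ (Fin (n + 1))) :
    ContDiff ℝ 1 (fun w : (Submodule.span ℝ {v})ᗮ =>
      stereoInvFunAux v (w : EuclideanSpace ℝ (Fin (n + 1)))) :=
  contDiff_stereoInvFunAux.comp (Submodule.subtypeL (Submodule.span ℝ {v})ᗮ).contDiff

theorem aux_finite (n : ℕ) : μH[(n:ℝ)] (sph n) < ⊤ := by
  refine (isCompact_sphere _ _).measure_lt_top_of_nhdsWithin ?_
  intro x hx
  have hx : ‖x‖ = 1 := by simpa using hx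
  have hv : ‖-x‖ = 1 := by simpa using hx
  have hxv := aux_ne n x hx
  set v := -x
  have := aux_haar n v hv
  obtain ⟨K, t, ht, hK⟩ := (aux_cd n v).contDiffAt (x := stereoToFun v x) |>.exists_lipschitzOnWith
  have hc := (aux_cdat n x v hv hx hxv).continuousAt
  have ht' := Filter.inter_mem ht (Metric.ball_mem_nhds (stereoToFun v x) one_pos)
  set t' := t ∩ Metric.ball (stereoToFun v x) 1
  refine ⟨{y | y ∈ sph n ∧ y ≠ v ∧ stereoToFun v y ∈ t'}, ?_, ?_⟩
  · filter_upwards [self_mem_nhdsWithin, nhdsWithin_le_nhds (hc ht'),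
      nhdsWithin_le_nhds (isOpen_ne.mem_nhds hxv)] with y h1 h2 h3
    exact ⟨h1, h3, h2⟩
  · have h1 := (hK.mono (Set.inter_subset_left : t' ⊆ t)).hausdorffMeasure_image_le
      (d := n) (by positivity)
    refine lt_of_le_of_lt ((measure_mono ?_).trans h1) ?_
    · rintro y ⟨h1, h2, h3⟩
      exact ⟨_, h3, aux_left n y v hv (by simpa [sph] using h1) h2⟩
    · refine ENNReal.mul_lt_top ?_ ?_
      · exact ENNReal.rpow_lt_top_of_nonneg (by positivity) ENNReal.coe_ne_top
      · exact (measure_mono Set.inter_subset_right).trans_lt Metric.isBounded_ball.measure_lt_top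

theorem aux_pos (n : ℕ) (U : Set (EuclideanSpace ℝ (Fin (n + 1)))) (hU : IsOpen U)
    (x : EuclideanSpace ℝ (Fin (n + 1))) (hx : ‖x‖ = 1) (hxU : x ∈ U) :
    0 < μH[(n:ℝ)] (U ∩ sph n) := by
  have hv : ‖-x‖ = 1 := by simpa using hx
  have hxv := aux_ne n x hx
  set v := -x
  have := aux_haar n v hv
  obtain ⟨K, t, ht, hK⟩ := (aux_cdat n x v hv hx hxv).exists_lipschitzOnWith
  have hc : ContinuousAt _ (stereoToFun v x) := (aux_cd n v).continuous.continuousAt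
  have hl := aux_left n x v hv hx hxv
  have hW := hc (by simpa only [hl] using Filter.inter_mem (hU.mem_nhds hxU) ht)
  have h0 := Measure.measure_pos_of_mem_nhds (μH[(n:ℝ)] : Measure (Submodule.span ℝ {v})ᗮ) hW
  have h1 := (hK.mono (Set.inter_subset_right : U ∩ sph n ∩ t ⊆ t)).hausdorffMeasure_image_le
      (d := n) (by positivity)
  by_contra hcon
  have hz : μH[(n:ℝ)] (U ∩ sph n ∩ t) = 0 := by
    refine measure_mono_null Set.inter_subset_left ?_
    simpa using hcon
  rw [hz, mul_zero] at h1
  refine absurd (h0.trans_le ((measure_mono ?_).trans h1)) (lt_irrefl _)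
  intro w hw
  refine ⟨stereoInvFun hv w, ⟨⟨hw.1, (stereoInvFun hv w).2⟩, hw.2⟩, stereo_right_inv hv w⟩

theorem aux_Gcont (g : ℝ → ℝ) (hg_cont : ContinuousOn g (Set.Icc (-1) 1)) :
    ContinuousOn (Gfun g) (Set.Icc (-1) 1) := by
  have h : IntervalIntegrable g volume (-1) 1 :=
    ContinuousOn.intervalIntegrable (by rwa [Set.uIcc_of_le (by norm_num)])
  have := intervalIntegral.continuousOn_primitive_interval' h (a := 0)
    (by rw [Set.uIcc_of_le (by norm_num)]; norm_num)
  rwa [Set.uIcc_of_le (by norm_num)] at this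

theorem aux_Gmono (g : ℝ → ℝ) (hg_cont : ContinuousOn g (Set.Icc (-1) 1))
    (hg_pos : ∀ t ∈ Set.Ioo (-1:ℝ) 1, 0 < g t) :
    StrictMonoOn (Gfun g) (Set.Icc (-1) 1) := by
  intro a ha b hb hab
  have hint : ∀ c ∈ Set.Icc (-1:ℝ) 1, ∀ d ∈ Set.Icc (-1:ℝ) 1,
      IntervalIntegrable g volume c d := fun c hc d hd =>
    (hg_cont.mono (Set.uIcc_subset_Icc hc hd)).intervalIntegrable
  have h0 : (0:ℝ) ∈ Set.Icc (-1:ℝ) 1 := by norm_num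
  have := intervalIntegral.intervalIntegral_pos_of_pos_on (hint a ha b hb)
    (fun x hx => hg_pos x ⟨ha.1.trans_lt hx.1, hx.2.trans_le hb.2⟩) hab
  have h2 := intervalIntegral.integral_interval_sub_left (hint 0 h0 b hb) (hint 0 h0 a ha)
  unfold Gfun
  linarith

theorem aux_inner_mem (n : ℕ) (x y : EuclideanSpace ℝ (Fin (n + 1))) (hx : ‖x‖ = 1)
    (hy : ‖y‖ = 1) : ⟪x, y⟫ ∈ Set.Icc (-1:ℝ) 1 := by
  have := abs_real_inner_le_norm x y
  rw [hx, hy, mul_one] at this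
  exact abs_le.1 this

theorem aux_integrable (n : ℕ) (g : ℝ → ℝ) (hg_cont : ContinuousOn g (Set.Icc (-1) 1))
    (z : EuclideanSpace ℝ (Fin (n + 1))) (hz : ‖z‖ = 1) :
    IntegrableOn (fun v => Gfun g ⟪z, v⟫) (sph n) μH[(n:ℝ)] := by
  have hc : ContinuousOn (fun v => Gfun g ⟪z, v⟫) (sph n) := by
    refine (aux_Gcont g hg_cont).comp (by fun_prop) ?_
    intro v hv
    exact aux_inner_mem n z v hz (by simpa [sph] using hv)
  have hcpt : IsCompact (sph n) := isCompact_sphere _ _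
  obtain ⟨C, hC⟩ := hcpt.exists_bound_of_continuousOn hc
  refine IntegrableOn.of_bound (C := C) (aux_finite n)
    (hc.aestronglyMeasurable hcpt.measurableSet) ?_
  exact (ae_restrict_iff' hcpt.measurableSet).2 (Filter.Eventually.of_forall hC)

theorem aux_gball (n : ℕ) (p : EuclideanSpace ℝ (Fin (n + 1))) (hp : ‖p‖ = 1) (r : ℝ)
    (hr : r ∈ Set.Ioo 0 (π / 2)) :
    gball n p r = {v | Real.cos r < ⟪p, v⟫} ∩ sph n := by
  ext v
  simp only [gball, Set.mem_ofPred_eq, Set.mem_inter_iff]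
  rw [and_comm]
  refine and_congr_left fun hv => ?_
  have hm := aux_inner_mem n p v hp (by simpa [sph] using hv)
  have hpi := Real.pi_pos
  constructor
  · intro h
    have := Real.cos_lt_cos_of_nonneg_of_le_pi (Real.arccos_nonneg _) (by linarith [hr.2]) h
    rwa [Real.cos_arccos hm.1 hm.2] at this
  · intro h
    have := Real.arccos_lt_arccos (Real.neg_one_le_cos r) h hm.2
    rwa [Real.arccos_cos hr.1.le (by linarith [hr.2])] at this

theorem aux_exists (n : ℕ) (hn : 2 ≤ n) (p b : EuclideanSpace ℝ (Fin (n + 1)))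
    (hp : ‖p‖ = 1) (hb : 0 < ⟪p, b⟫) (k : ℝ) (hk : 0 < k) (r : ℝ)
    (hr : r ∈ Set.Ioo 0 (π / 2)) :
    ∃ v, ‖v‖ = 1 ∧ Real.cos r < ⟪p, v⟫ ∧ ⟪p, v⟫ - k * ⟪b, v⟫ < Real.cos r := by
  have hw : ∃ w : EuclideanSpace ℝ (Fin (n + 1)), ‖w‖ = 1 ∧ ⟪p, w⟫ = 0 ∧ 0 ≤ ⟪b, w⟫ := by
    have hnt : Nontrivial (Submodule.span ℝ {p})ᗮ :=
      Module.nontrivial_of_finrank_pos (R := ℝ) (by rw [aux_finrank n p hp]; omega)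
    obtain ⟨w, hw⟩ := exists_norm_eq (Submodule.span ℝ {p})ᗮ (zero_le_one (α := ℝ))
    have hpw : ⟪p, (w : EuclideanSpace ℝ (Fin (n + 1)))⟫ = 0 :=
      Submodule.mem_orthogonal_singleton_iff_inner_right.1 w.2
    rcases le_total 0 ⟪b, (w : EuclideanSpace ℝ (Fin (n + 1)))⟫ with h | h
    · exact ⟨w, hw, hpw, h⟩
    · exact ⟨-w, by simpa using hw, by simpa using hpw, by simpa using h⟩
  obtain ⟨w, hw1, hpw, hbw⟩ := hw
  have hev : ∀ᶠ t in nhds r, Real.cos t - k * (Real.cos t * ⟪b, p⟫ + Real.sin t * ⟪b, w⟫)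
      < Real.cos r := by
    have hcont : Continuous fun t => Real.cos t - k * (Real.cos t * ⟪b, p⟫ + Real.sin t * ⟪b, w⟫) := by
      fun_prop
    refine hcont.continuousAt.eventually_lt continuousAt_const ?_
    have h1 : 0 < Real.cos r := Real.cos_pos_of_mem_Ioo ⟨by linarith [hr.1, hr.2], hr.2⟩
    have h2 : 0 < Real.sin r := Real.sin_pos_of_pos_of_lt_pi hr.1 (by linarith [hr.2, Real.pi_pos])
    rw [real_inner_comm] at hb
    have : 0 < k * (Real.cos r * ⟪b, p⟫ + Real.sin r * ⟪b, w⟫) := by positivity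
    linarith
  obtain ⟨t, ht, ht0, htr⟩ : ∃ t, _ ∧ 0 < t ∧ t < r := by
    have h1 := (hev.filter_mono (nhdsWithin_le_nhds (s := Set.Iio r)))
    have h2 : ∀ᶠ t in nhdsWithin r (Set.Iio r), 0 < t :=
      nhdsWithin_le_nhds (lt_mem_nhds hr.1)
    exact (h1.and (h2.and self_mem_nhdsWithin)).exists
  have hpv : ⟪p, Real.cos t • p + Real.sin t • w⟫ = Real.cos t := by
    rw [inner_add_right, inner_smul_right, inner_smul_right, hpw, real_inner_self_eq_norm_sq, hp]
    ring
  refine ⟨Real.cos t • p + Real.sin t • w, ?_, ?_, ?_⟩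
  · have : ‖Real.cos t • p + Real.sin t • w‖ ^ 2 = 1 := by
      rw [norm_add_sq_real, inner_smul_left, inner_smul_right, hpw, norm_smul, norm_smul, hp, hw1]
      simp
    exact (pow_eq_one_iff_of_nonneg (norm_nonneg _) two_ne_zero).1 this
  · rw [hpv]
    exact Real.cos_lt_cos_of_nonneg_of_le_pi ht0.le (by linarith [hr.2, Real.pi_pos]) htr
  · rw [hpv, inner_add_right, inner_smul_right, inner_smul_right]
    exact ht

/-- For `p ∈ Sⁿ` and `r ∈ (0, π/2)`, the function `G_r` with
`G_r(z·p) = ∫_{B_{p,r}} G(z·v) dv` is strictly increasing: if `z·p < z'·p` then the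
corresponding integrals are strictly ordered. -/
theorem statement2 (n : ℕ) (hn : 2 ≤ n)
    (g : ℝ → ℝ) (hg_cont : ContinuousOn g (Set.Icc (-1) 1))
    (hg_even : ∀ t, g (-t) = g t)
    (hg_nonneg : ∀ t ∈ Set.Icc (-1:ℝ) 1, 0 ≤ g t)
    (hg_pos : ∀ t ∈ Set.Ioo (-1:ℝ) 1, 0 < g t)
    (p : EuclideanSpace ℝ (Fin (n + 1))) (hp : p ∈ sph n)
    (r : ℝ) (hr : r ∈ Set.Ioo 0 (π / 2))
    (z z' : EuclideanSpace ℝ (Fin (n + 1))) (hz : z ∈ sph n) (hz' : z' ∈ sph n)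
    (hzz' : ⟪z, p⟫ < ⟪z', p⟫) :
    (∫ v in gball n p r, Gfun g ⟪z, v⟫ ∂μH[(n:ℝ)]) <
      ∫ v in gball n p r, Gfun g ⟪z', v⟫ ∂μH[(n:ℝ)] := by
  have hp : ‖p‖ = 1 := by simpa [sph] using hp
  have hz : ‖z‖ = 1 := by simpa [sph] using hz
  have hz' : ‖z'‖ = 1 := by simpa [sph] using hz'
  set R : EuclideanSpace ℝ (Fin (n + 1)) ≃ₗᵢ[ℝ] EuclideanSpace ℝ (Fin (n + 1)) :=
    (Submodule.span ℝ {z' - z})ᗮ.reflection with hR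
  have hRz : R z' = z := Submodule.reflection_sub (hz'.trans hz.symm)
  have hRR : ∀ x, R (R x) = x := fun x => Submodule.reflection_reflection _ x
  have hRi : ∀ x y, ⟪x, R y⟫ = ⟪R x, y⟫ := fun x y => by
    rw [← R.inner_map_map x (R y), hRR]
  have hb : 0 < ⟪p, z' - z⟫ := by
    rw [inner_sub_right, real_inner_comm, real_inner_comm z p]; linarith
  have hbn : 0 < ‖z' - z‖ := by
    rw [norm_pos_iff]; intro h; simp [h] at hb
  set k : ℝ := 2 / ‖z' - z‖ ^ 2 * ⟪p, z' - z⟫ with hk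
  have hkpos : 0 < k := by positivity
  have hRp : ∀ v, ⟪p, R v⟫ = ⟪p, v⟫ - k * ⟪z' - z, v⟫ := by
    intro v
    rw [hR, Submodule.reflection_orthogonal_apply, Submodule.reflection_singleton_apply, neg_sub,
      inner_sub_right, two_smul, inner_add_right, inner_smul_right, hk]
    simp only [RCLike.ofReal_real_eq_id, id]
    ring
  have hRm : MeasurePreserving R (μH[(n:ℝ)]) (μH[(n:ℝ)]) :=
    R.toIsometryEquiv.measurePreserving_hausdorffMeasure n
  have hRe : MeasurableEmbedding R := R.toHomeomorph.measurableEmbedding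
  set B := gball n p r with hB
  have hBeq := aux_gball n p hp r hr
  have hsm : MeasurableSet (sph n) := (isCompact_sphere _ _).measurableSet
  have hBm : MeasurableSet B := by
    rw [hB, hBeq]
    exact (isOpen_lt continuous_const (by fun_prop)).measurableSet.inter hsm
  have hBs : B ⊆ sph n := fun v hv => hv.1
  set D : EuclideanSpace ℝ (Fin (n + 1)) → ℝ := fun v => Gfun g ⟪z', v⟫ - Gfun g ⟪z, v⟫ with hD
  have hi := (aux_integrable n g hg_cont z hz).mono_set hBs
  have hi' := (aux_integrable n g hg_cont z' hz').mono_set hBs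
  have hDi : IntegrableOn D B μH[(n:ℝ)] := hi'.sub hi
  have hDR : ∀ v, D (R v) = - D v := by
    intro v
    simp only [hD]
    rw [hRi, hRi, hRz, ← hRz, hRR, hRz]; ring
  rw [← sub_pos, ← integral_sub hi' hi]
  change 0 < ∫ v in B, D v ∂μH[(n:ℝ)]
  have hRBm : MeasurableSet (R ⁻¹' B) := hRe.measurable hBm
  rw [← integral_inter_add_sdiff hRBm hDi]
  have hzero : ∫ v in B ∩ R ⁻¹' B, D v ∂μH[(n:ℝ)] = 0 := by
    have h := hRm.setIntegral_preimage_emb hRe D (B ∩ R ⁻¹' B)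
    have hs : R ⁻¹' (B ∩ R ⁻¹' B) = B ∩ R ⁻¹' B := by
      ext v; simp [hRR, and_comm]
    rw [hs] at h
    simp only [hDR, integral_neg] at h
    linarith
  rw [hzero, zero_add]
  have hpos : ∀ v ∈ B \ R ⁻¹' B, 0 < D v := by
    rintro v ⟨h1, h2⟩
    have hv : ‖v‖ = 1 := by simpa [sph] using hBs h1
    have hRv : R v ∈ sph n := by simp [sph, hv]
    rw [hB, hBeq] at h1 h2
    have h3 : ⟪p, R v⟫ ≤ Real.cos r := by
      by_contra hc
      exact h2 ⟨not_le.1 hc, hRv⟩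
    have h4 : Real.cos r < ⟪p, v⟫ := h1.1
    rw [hRp] at h3
    have h5 : 0 < ⟪z' - z, v⟫ := by
      by_contra hc
      nlinarith
    rw [inner_sub_left] at h5
    have := aux_Gmono g hg_cont hg_pos (aux_inner_mem n z v hz hv) (aux_inner_mem n z' v hz' hv)
      (by linarith)
    simp only [hD]; linarith
  have hm : MeasurableSet (B \ R ⁻¹' B) := hBm.diff hRBm
  rw [setIntegral_pos_iff_support_of_nonneg_ae
    ((ae_restrict_iff' hm).2 (Filter.Eventually.of_forall fun v hv => (hpos v hv).le))
    (hDi.mono_set Set.sdiff_subset)]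
  obtain ⟨x, hx1, hx2, hx3⟩ := aux_exists n hn p (z' - z) hp hb k hkpos r hr
  have hU : IsOpen {v : EuclideanSpace ℝ (Fin (n + 1)) |
      Real.cos r < ⟪p, v⟫ ∧ ⟪p, v⟫ - k * ⟪z' - z, v⟫ < Real.cos r} := by
    have h1 : IsOpen {v : EuclideanSpace ℝ (Fin (n + 1)) | Real.cos r < ⟪p, v⟫} :=
      isOpen_lt continuous_const (by fun_prop)
    have h2 : IsOpen {v : EuclideanSpace ℝ (Fin (n + 1)) |
        ⟪p, v⟫ - k * ⟪z' - z, v⟫ < Real.cos r} :=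
      isOpen_lt (by fun_prop) continuous_const
    exact h1.inter h2
  refine (aux_pos n _ hU x hx1 ⟨hx2, hx3⟩).trans_le (measure_mono ?_)
  rintro v ⟨⟨h1, h2⟩, h3⟩
  have hmem : v ∈ B \ R ⁻¹' B := by
    refine ⟨by rw [hB, hBeq]; exact ⟨h1, h3⟩, fun h => ?_⟩
    rw [hB, hBeq] at h
    have h4 : Real.cos r < ⟪p, R v⟫ := h.1
    rw [hRp] at h4
    linarith
  exact ⟨(hpos v hmem).ne', hmem⟩
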